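/- arXiv:2103.02057 — 3 statements merged into one kernel-verified Lean document; each statement's English description precedes it below -/
import Mathlib

section
/- Let U₀ < U₁ be real numbers and let a, b, κ, r, ρ : [U₀, U₁] → ℝ be continuous functions with r(U) > 0 and ρ(U) ≥ 0 for all U ∈ [U₀, U₁]. Then ∫_{U₀}^{U₁} (4(a(U)+b(U)+6κ(U)/r(U))² + (2/3)(a(U)²+b(U)²)) · ρ(U) · r(U)² dU ≥ (144/13) ∫_{U₀}^{U₁} κ(U)² ρ(U) dU. -/
open intervalIntegral

/-- Pointwise bound `4(a+b+6κ/r)² + (2/3)(a²+b²) ≥ (144/13)(κ/r)²`, weighted by `ρ r²`. -/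
theorem quadratic_form_lower_bound {a b κ r ρ : ℝ} (hr : r ≠ 0) (hρ : 0 ≤ ρ) :
    144 / 13 * (κ ^ 2 * ρ)
      ≤ (4 * (a + b + 6 * κ / r) ^ 2 + (2 / 3) * (a ^ 2 + b ^ 2)) * ρ * r ^ 2 := by
  have key : (4 * (a + b + 6 * κ / r) ^ 2 + (2 / 3) * (a ^ 2 + b ^ 2)) * ρ * r ^ 2
      = 144 / 13 * (κ ^ 2 * ρ)
        + ((13 * (a + b) * r + 72 * κ) ^ 2 / 39 + (a - b) ^ 2 * r ^ 2 / 3) * ρ := by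
    field_simp
    ring
  rw [key]
  exact le_add_of_nonneg_right (by positivity)

/-- Integral lower bound on the anomaly source term `γ₃`: if `a`, `b`, `κ`, `r`, `ρ`
are continuous on `[U₀, U₁]` with `r > 0` and `ρ ≥ 0` there, then
`∫ (4(a+b+6κ/r)² + (2/3)(a²+b²)) ρ r² ≥ (144/13) ∫ κ² ρ`. -/
theorem gamma3_integral_bound (U₀ U₁ : ℝ) (hU : U₀ < U₁)
    (a b κ r ρ : ℝ → ℝ)
    (ha : ContinuousOn a (Set.Icc U₀ U₁))
    (hb : ContinuousOn b (Set.Icc U₀ U₁))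
    (hκ : ContinuousOn κ (Set.Icc U₀ U₁))
    (hr : ContinuousOn r (Set.Icc U₀ U₁))
    (hρ : ContinuousOn ρ (Set.Icc U₀ U₁))
    (hrpos : ∀ U ∈ Set.Icc U₀ U₁, 0 < r U)
    (hρnonneg : ∀ U ∈ Set.Icc U₀ U₁, 0 ≤ ρ U) :
    ∫ U in U₀..U₁,
        (4 * (a U + b U + 6 * κ U / r U) ^ 2
          + (2 / 3) * (a U ^ 2 + b U ^ 2)) * ρ U * (r U) ^ 2
      ≥ (144 / 13) * ∫ U in U₀..U₁, (κ U) ^ 2 * ρ U := by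
  rw [ge_iff_le, ← intervalIntegral.integral_const_mul]
  have hr0 : ∀ U ∈ Set.Icc U₀ U₁, r U ≠ 0 := fun U h => (hrpos U h).ne'
  refine intervalIntegral.integral_mono_on hU.le
    (ContinuousOn.intervalIntegrable_of_Icc hU.le ?_)
    (ContinuousOn.intervalIntegrable_of_Icc hU.le ?_)
    fun U h => quadratic_form_lower_bound (hr0 U h) (hρnonneg U h)
  · fun_prop
  · fun_prop (disch := assumption)
end

section
/- Let λ > 0 and M > 0, and let F : [2M, ∞) → ℝ be differentiable with F'(r) = 24λM²(r^{−5} − 2M r^{−6}) for all r ≥ 2M, and suppose F(r) → 0 as r → ∞. Then F(r) < 0 for every r ≥ 2M; indeed F(r) = −24λM²(5r − 8M)/(20 r⁵) < 0. -/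
open Filter

/-- Two functions with the same derivative on `[a, ∞)` and the same limit at infinity agree on
`[a, ∞)`. -/
theorem eqOn_Ici_of_hasDerivAt_of_tendsto {F G f : ℝ → ℝ} {a l : ℝ}
    (hF : ∀ r ≥ a, HasDerivAt F (f r) r) (hG : ∀ r ≥ a, HasDerivAt G (f r) r)
    (hFl : Tendsto F atTop (nhds l)) (hGl : Tendsto G atTop (nhds l)) :
    Set.EqOn F G (Set.Ici a) := by
  intro r hr
  have hr : a ≤ r := hr
  have hD : ∀ x ≥ a, HasDerivAt (fun y => F y - G y) 0 x := fun x hx => by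
    simpa using (hF x hx).fun_sub (hG x hx)
  have hconst : ∀ x ≥ r, F x - G x = F r - G r := fun x hx =>
    constant_of_has_deriv_right_zero (f := fun y => F y - G y)
      (fun y hy => (hD y (hr.trans hy.1)).continuousAt.continuousWithinAt)
      (fun y hy => (hD y (hr.trans hy.1)).hasDerivWithinAt) x ⟨hx, le_rfl⟩
  have hlim : Tendsto (fun x => F x - G x) atTop (nhds (F r - G r)) :=
    tendsto_const_nhds.congr' <| (eventually_ge_atTop r).mono fun x hx => (hconst x hx).symm
  have h := tendsto_nhds_unique hlim (hFl.sub hGl)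
  linarith

theorem hasDerivAt_vaidya_flux (c M : ℝ) {r : ℝ} (hr : r ≠ 0) :
    HasDerivAt (fun x : ℝ => c * (2 * M / 5 * (x ^ 5)⁻¹ - 1 / 4 * (x ^ 4)⁻¹))
      (c * (1 / r ^ 5 - 2 * M / r ^ 6)) r := by
  have h5 := ((hasDerivAt_pow 5 r).fun_inv (pow_ne_zero 5 hr)).const_mul (2 * M / 5)
  have h4 := ((hasDerivAt_pow 4 r).fun_inv (pow_ne_zero 4 hr)).const_mul (1 / 4 : ℝ)
  refine ((h5.fun_sub h4).const_mul c).congr_deriv ?_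
  push_cast
  field_simp
  ring

theorem tendsto_vaidya_flux (c M : ℝ) :
    Tendsto (fun x : ℝ => c * (2 * M / 5 * (x ^ 5)⁻¹ - 1 / 4 * (x ^ 4)⁻¹)) atTop (nhds 0) := by
  have h (n : ℕ) (hn : n ≠ 0) : Tendsto (fun x : ℝ => (x ^ n)⁻¹) atTop (nhds 0) :=
    (tendsto_pow_atTop hn).inv_tendsto_atTop
  simpa using (((h 5 (by norm_num)).const_mul (2 * M / 5)).sub
    ((h 4 (by norm_num)).const_mul (1 / 4 : ℝ))).const_mul c

/-- If `F` solves `F'(r) = 24λM²(r⁻⁵ - 2M r⁻⁶)` on `[2M, ∞)` and `F(r) → 0`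
as `r → ∞`, then `F(r) = -24λM²(5r - 8M)/(20 r⁵) < 0` for every `r ≥ 2M`. -/
theorem vaidya_flux_negative (lam M : ℝ) (hlam : 0 < lam) (hM : 0 < M)
    (F : ℝ → ℝ)
    (hF : ∀ r ≥ 2 * M, HasDerivAt F (24 * lam * M ^ 2 * (1 / r ^ 5 - 2 * M / r ^ 6)) r)
    (hF0 : Tendsto F atTop (nhds 0)) :
    ∀ r ≥ 2 * M, F r = -(24 * lam * M ^ 2) * (5 * r - 8 * M) / (20 * r ^ 5) ∧ F r < 0 := by
  intro r hr
  have hr0 : 0 < r := by linarith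
  have hval : F r = -(24 * lam * M ^ 2) * (5 * r - 8 * M) / (20 * r ^ 5) := by
    rw [eqOn_Ici_of_hasDerivAt_of_tendsto hF
      (fun x hx => hasDerivAt_vaidya_flux _ M (by linarith : 0 < x).ne') hF0
      (tendsto_vaidya_flux _ M) hr]
    field_simp
    ring
  refine ⟨hval, ?_⟩
  have hpos : 0 < 5 * r - 8 * M := by linarith
  rw [hval, neg_mul, neg_div, neg_lt_zero]
  positivity
end

section
/- Let λ > 0, v₀ < v₁, and let M : [v₀, v₁] → ℝ be differentiable with M(v) > 0 for all v. Suppose that for each v ∈ [v₀, v₁] there is a differentiable function F_v : [2M(v), ∞) → ℝ satisfying F_v'(r) = 24λM(v)²(r^{−5} − 2M(v) r^{−6}) for all r ≥ 2M(v) and F_v(r) → 0 as r → ∞, and that M'(v) = 4π F_v(2M(v)). Then M'(v) = −3πλ/(10 M(v)²) for all v, and consequently M(v)³ = M(v₀)³ − (9πλ/10)(v − v₀) for all v ∈ [v₀, v₁]. -/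
open Real Filter

/-- A function with zero derivative on `[a, ∞)` that tends to `l` at infinity takes the value `l`
at `a`. -/
theorem eq_of_hasDerivAt_zero_of_tendsto_atTop {f : ℝ → ℝ} {a l : ℝ}
    (hf : ∀ r ≥ a, HasDerivAt f 0 r) (hl : Tendsto f atTop (nhds l)) : f a = l := by
  have hconst : ∀ r ≥ a, f r = f a := fun r hr =>
    constant_of_has_deriv_right_zero
      (fun x hx => (hf x hx.1).continuousAt.continuousWithinAt)
      (fun x hx => (hf x hx.1).hasDerivWithinAt) r ⟨hr, le_rfl⟩
  refine tendsto_nhds_unique (tendsto_const_nhds.congr' ?_) hl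
  filter_upwards [eventually_ge_atTop a] with r hr
  exact (hconst r hr).symm

/-- An antiderivative of the radial source term of the rescaled ingoing flux. -/
theorem hasDerivAt_flux_antiderivative (c m : ℝ) {r : ℝ} (hr : r ≠ 0) :
    HasDerivAt (fun x : ℝ => c * (-(1 / 4) * (x ^ 4)⁻¹ + 2 * m / 5 * (x ^ 5)⁻¹))
      (c * (1 / r ^ 5 - 2 * m / r ^ 6)) r := by
  have h4 := ((hasDerivAt_pow 4 r).inv (pow_ne_zero 4 hr)).const_mul (-(1 / 4 : ℝ))
  have h5 := ((hasDerivAt_pow 5 r).inv (pow_ne_zero 5 hr)).const_mul (2 * m / 5)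
  refine ((h4.add h5).const_mul c).congr_deriv ?_
  push_cast
  field_simp
  ring

theorem tendsto_flux_antiderivative (c m : ℝ) :
    Tendsto (fun x : ℝ => c * (-(1 / 4) * (x ^ 4)⁻¹ + 2 * m / 5 * (x ^ 5)⁻¹)) atTop
      (nhds 0) := by
  have h4 : Tendsto (fun x : ℝ => (x ^ 4)⁻¹) atTop (nhds 0) :=
    (tendsto_pow_atTop (by norm_num)).inv_tendsto_atTop
  have h5 : Tendsto (fun x : ℝ => (x ^ 5)⁻¹) atTop (nhds 0) :=
    (tendsto_pow_atTop (by norm_num)).inv_tendsto_atTop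
  simpa using ((h4.const_mul (-(1 / 4 : ℝ))).add (h5.const_mul (2 * m / 5))).const_mul c

/-- The rescaled ingoing flux at the apparent horizon `r = 2m`. -/
theorem flux_at_horizon {lam m : ℝ} (hm : 0 < m) {F : ℝ → ℝ}
    (hF : ∀ r ≥ 2 * m,
      HasDerivAt F (24 * lam * m ^ 2 * (1 / r ^ 5 - 2 * m / r ^ 6)) r)
    (hlim : Tendsto F atTop (nhds 0)) :
    F (2 * m) = -3 * lam / (40 * m ^ 2) := by
  have h := eq_of_hasDerivAt_zero_of_tendsto_atTop (a := 2 * m) (l := 0)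
    (f := fun x => F x -
      24 * lam * m ^ 2 * (-(1 / 4) * (x ^ 4)⁻¹ + 2 * m / 5 * (x ^ 5)⁻¹))
    (fun r hr => by
      have hr0 : r ≠ 0 := by
        have : 0 < r := by linarith
        exact this.ne'
      exact ((hF r hr).sub
        (hasDerivAt_flux_antiderivative (24 * lam * m ^ 2) m hr0)).congr_deriv (sub_self _))
    (by simpa using hlim.sub (tendsto_flux_antiderivative (24 * lam * m ^ 2) m))
  rw [sub_eq_zero.mp h]
  field_simp
  ring

/-- Combined Vaidya evaporation result: if at each advanced time `v` the rescaled
ingoing flux `F_v` solves `F_v'(r) = 24λM(v)²(r⁻⁵ - 2M(v) r⁻⁶)` on `[2M(v), ∞)`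
with `F_v(r) → 0` at infinity, and `M'(v) = 4π F_v(2M(v))`, then
`M' = -3πλ/(10M²)` and the cubic evaporation law holds. -/
theorem vaidya_combined_evaporation (lam v₀ v₁ : ℝ) (hlam : 0 < lam) (hv : v₀ < v₁)
    (M : ℝ → ℝ)
    (hMpos : ∀ v ∈ Set.Icc v₀ v₁, 0 < M v)
    (hF : ∀ v ∈ Set.Icc v₀ v₁, ∃ F : ℝ → ℝ,
      (∀ r ≥ 2 * M v,
        HasDerivAt F (24 * lam * (M v) ^ 2 * (1 / r ^ 5 - 2 * M v / r ^ 6)) r) ∧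
      Tendsto F atTop (nhds 0) ∧
      HasDerivAt M (4 * π * F (2 * M v)) v) :
    (∀ v ∈ Set.Icc v₀ v₁,
      HasDerivAt M (-3 * π * lam / (10 * (M v) ^ 2)) v) ∧
    (∀ v ∈ Set.Icc v₀ v₁,
      (M v) ^ 3 = (M v₀) ^ 3 - (9 * π * lam / 10) * (v - v₀)) := by
  have hderiv : ∀ v ∈ Set.Icc v₀ v₁,
      HasDerivAt M (-3 * π * lam / (10 * (M v) ^ 2)) v := by
    intro v hvI
    obtain ⟨F, hF', hlim, hM⟩ := hF v hvI
    have hm := hMpos v hvI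
    rw [flux_at_horizon hm hF' hlim] at hM
    convert hM using 1
    field_simp
    norm_num
  refine ⟨hderiv, fun v hvI => ?_⟩
  have hcube : ∀ x ∈ Set.Icc v₀ v₁,
      HasDerivAt (fun x => (M x) ^ 3 + (9 * π * lam / 10) * (x - v₀)) 0 x := by
    intro x hx
    have hm := hMpos x hx
    have h := ((hderiv x hx).pow 3).add
      (((hasDerivAt_id x).sub_const v₀).const_mul (9 * π * lam / 10))
    refine h.congr_deriv ?_
    push_cast
    field_simp
    norm_num
  have h := constant_of_has_deriv_right_zero
    (fun x hx => (hcube x hx).continuousAt.continuousWithinAt)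
    (fun x hx => (hcube x (Set.Ico_subset_Icc_self hx)).hasDerivWithinAt) v hvI
  simp only [sub_self, mul_zero, add_zero] at h
  linarith
end
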